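/- The number of plane labelled bipartite trees with n white vertices and m black vertices (n, m ≥ 1) is ((n+m-2)!)² / ((n-1)!·(m-1)!). -/

import Mathlib

/-- A plane labelled bipartite tree with white vertices `Fin n` and black vertices `Fin m`:
an adjacency relation together with a rotation system (a cyclic order of the neighbours
around each vertex), whose underlying bipartite graph is a tree. -/
structure PlaneLabelledBipartiteTree (n m : ℕ) where
  adj : Fin n → Fin m → Bool
  rotW : Fin n → Equiv.Perm (Fin m)
  rotB : Fin m → Equiv.Perm (Fin n)
  rotW_cycle : ∀ i, (rotW i).IsCycleOn {j | adj i j = true}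
  rotW_fix : ∀ i j, adj i j = false → rotW i j = j
  rotB_cycle : ∀ j, (rotB j).IsCycleOn {i | adj i j = true}
  rotB_fix : ∀ j i, adj i j = false → rotB j i = i
  connected : (SimpleGraph.fromRel (fun x y : Fin n ⊕ Fin m =>
      ∃ i j, x = Sum.inl i ∧ y = Sum.inr j ∧ adj i j = true)).Connected
  card_edges : (Finset.univ.filter (fun p : Fin n × Fin m => adj p.1 p.2 = true)).card
      = n + m - 1

open Equiv in
theorem cyc_univ_card (α : Type) [Fintype α] [DecidableEq α] (h : 0 < Fintype.card α) :
    Nat.card {g : Perm α // g.IsCycleOn Set.univ} = (Fintype.card α - 1).factorial := by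
  rcases Nat.lt_or_ge (Fintype.card α) 2 with h2 | h2
  · have h1 : Fintype.card α = 1 := by omega
    have : Subsingleton α := Fintype.card_le_one_iff_subsingleton.1 h1.le
    rw [h1]
    simp only [Nat.sub_self, Nat.factorial_zero]
    rw [Nat.card_eq_one_iff_unique]
    exact ⟨inferInstance, ⟨⟨1, Perm.isCycleOn_of_subsingleton _ _⟩⟩⟩
  · have := Perm.card_of_cycleType_singleton (α := α) h2 le_rfl
    rw [Nat.choose_self, mul_one] at this
    classical
    rw [← this, Nat.card_eq_fintype_card, Fintype.card_subtype]
    congr 1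
    ext g
    simp only [Finset.mem_filter, Finset.mem_univ, true_and]
    have : Nontrivial α := Fintype.one_lt_card_iff_nontrivial.1 h2
    constructor
    · intro hg
      have hne : ∀ a, g a ≠ a := fun a => hg.apply_ne Set.nontrivial_univ (Set.mem_univ a)
      have hc : g.IsCycle := by
        rw [Perm.isCycle_iff_exists_isCycleOn]
        exact ⟨_, Set.nontrivial_univ, hg, fun _ _ => Set.mem_univ _⟩
      rw [hc.cycleType]
      congr 1
      have : g.support = Finset.univ := by ext a; simp [hne a]
      rw [this]; rfl
    · intro hg
      have hc : g.IsCycle := by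
        rw [← Perm.card_cycleType_eq_one, hg]; rfl
      have hs : g.support.card = Fintype.card α := by
        rw [← Perm.sum_cycleType, hg]; simp
      have hu := Finset.eq_univ_of_card _ hs
      have h3 := hc.isCycleOn
      convert! h3
      ext a
      have : a ∈ g.support := by rw [hu]; simp
      simpa using this

open Equiv in
theorem cyc_card {k : ℕ} (p : Fin k → Bool) (hp : 0 < ∑ j, (p j).toNat) :
    Nat.card {f : Perm (Fin k) // f.IsCycleOn {j | p j = true} ∧ ∀ j, p j = false → f j = j}
      = ((∑ j, (p j).toNat) - 1).factorial := by
  have hc : Fintype.card {j // p j = true} = ∑ j, (p j).toNat := by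
    rw [Fintype.card_subtype, Finset.card_filter]
    refine Finset.sum_congr rfl fun j _ => ?_
    cases p j <;> rfl
  rw [← hc] at hp ⊢
  rw [← cyc_univ_card _ hp]
  refine Nat.card_congr
    { toFun := fun f => ⟨f.1.subtypePerm fun _ => f.2.1.apply_mem_iff, f.2.1.subtypePerm⟩
      invFun := fun g => ⟨Perm.ofSubtype g.1, ?_, ?_⟩
      left_inv := ?_
      right_inv := ?_ }
  · obtain ⟨g, hg⟩ := g
    refine ⟨(Perm.ofSubtype g).bijOn fun x => ?_, ?_⟩
    · exact Perm.ofSubtype_apply_mem_iff_mem g x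
    · intro x hx y hy
      obtain ⟨n, hn⟩ := hg.2 (Set.mem_univ ⟨x, hx⟩) (Set.mem_univ ⟨y, hy⟩)
      refine ⟨n, ?_⟩
      rw [← map_zpow, Perm.ofSubtype_apply_of_mem _ hx, hn]
  · intro j hj
    exact Perm.ofSubtype_apply_of_not_mem _ (by simp [hj])
  · rintro ⟨f, hf⟩
    apply Subtype.ext
    refine Perm.ofSubtype_subtypePerm (p := fun j => p j = true) (fun _ => hf.1.apply_mem_iff) ?_
    intro x hx
    by_contra h
    exact hx (hf.2 x (by simpa using h))
  · rintro ⟨g, hg⟩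
    apply Subtype.ext
    exact Perm.subtypePerm_ofSubtype g

theorem comp_card (n k : ℕ) (hn : 1 ≤ n) :
    (Finset.piAntidiag (Finset.univ : Finset (Fin n)) k).card = (n - 1 + k).choose k := by
  have h := Nat.card_congr (Sym.equivNatSumOfFintype (α := Fin n) (n := k))
  rw [Nat.card_eq_fintype_card, Sym.card_sym_eq_choose, Fintype.card_fin] at h
  rw [show n - 1 + k = n + k - 1 by omega, h]
  symm
  rw [← Nat.card_eq_finsetCard]
  exact Nat.card_congr (Equiv.subtypeEquivRight fun f => by simp)
/-- combinatorial connectivity -/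
def BConn {n m : ℕ} (A : Fin n → Fin m → Bool) : Prop :=
  ∀ (f : Fin n → Prop) (g : Fin m → Prop), (∀ i j, A i j = true → (f i ↔ g j)) →
    ∃ c : Prop, (∀ i, f i ↔ c) ∧ (∀ j, g j ↔ c)

theorem bconn_iff {n m : ℕ} (hm : 1 ≤ m) (A : Fin n → Fin m → Bool) :
    (SimpleGraph.fromRel (fun x y : Fin n ⊕ Fin m =>
      ∃ i j, x = Sum.inl i ∧ y = Sum.inr j ∧ A i j = true)).Connected ↔ BConn A := by
  set G := SimpleGraph.fromRel (fun x y : Fin n ⊕ Fin m =>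
      ∃ i j, x = Sum.inl i ∧ y = Sum.inr j ∧ A i j = true) with hG
  have hadj : ∀ i j, A i j = true → G.Adj (Sum.inl i) (Sum.inr j) := by
    intro i j h
    rw [hG, SimpleGraph.fromRel_adj]
    exact ⟨by simp, Or.inl ⟨i, j, rfl, rfl, h⟩⟩
  let z : Fin n ⊕ Fin m := Sum.inr ⟨0, hm⟩
  constructor
  · intro hc f g hfg
    let F : Fin n ⊕ Fin m → Prop := Sum.elim f g
    have hw : ∀ x y, G.Adj x y → (F x ↔ F y) := by
      intro x y h
      rw [hG, SimpleGraph.fromRel_adj] at h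
      rcases h with ⟨_, ⟨i, j, rfl, rfl, h⟩ | ⟨i, j, rfl, rfl, h⟩⟩
      · exact hfg i j h
      · exact (hfg i j h).symm
    have hr : ∀ x, F x ↔ F z := by
      intro x
      obtain ⟨w⟩ := hc.preconnected x z
      generalize z = z' at w ⊢
      induction w with
      | nil => rfl
      | cons h _ ih => exact (hw _ _ h).trans ih
    exact ⟨F z, fun i => hr (Sum.inl i), fun j => hr (Sum.inr j)⟩
  · intro hb
    have key : ∀ x, G.Reachable z x := by
      obtain ⟨c, h1, h2⟩ := hb (fun i => G.Reachable z (Sum.inl i))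
        (fun j => G.Reachable z (Sum.inr j)) (fun i j h =>
          ⟨fun h' => h'.trans (hadj i j h).reachable,
            fun h' => h'.trans (hadj i j h).reachable.symm⟩)
      have hcc : c := (h2 ⟨0, hm⟩).1 (SimpleGraph.Reachable.refl _)
      rintro (i | j)
      · exact (h1 i).2 hcc
      · exact (h2 j).2 hcc
    have : Nonempty (Fin n ⊕ Fin m) := ⟨z⟩
    exact ⟨fun x y => (key x).symm.trans (key y)⟩

theorem bconn_flip {n m : ℕ} {A : Fin n → Fin m → Bool} (h : BConn A) :
    BConn (fun j i => A i j) := by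
  intro f g hfg
  obtain ⟨c, h1, h2⟩ := h g f (fun i j hij => (hfg j i hij).symm)
  exact ⟨c, h2, h1⟩

theorem bconn_insert {n m : ℕ} (i : Fin (n + 1)) (j : Fin m) (A : Fin n → Fin m → Bool) :
    BConn (Fin.insertNth i (fun j' => decide (j' = j)) A : Fin (n + 1) → Fin m → Bool) ↔ BConn A := by
  constructor
  · intro h f g hfg
    obtain ⟨c, h1, h2⟩ := h (Fin.insertNth i (g j) f) g (by
      rw [Fin.forall_iff_succAbove i]
      refine ⟨?_, ?_⟩
      · intro j' hj'
        simp at hj'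
        simp [hj']
      · intro i' j' h'
        simp at h' ⊢
        exact hfg i' j' h')
    exact ⟨c, fun i' => by simpa using h1 (i.succAbove i'), h2⟩
  · intro h f g hfg
    obtain ⟨c, h1, h2⟩ := h (fun i' => f (i.succAbove i')) g (fun i' j' h' =>
      hfg _ _ (by simpa using h'))
    refine ⟨c, ?_, h2⟩
    rw [Fin.forall_iff_succAbove i]
    exact ⟨(hfg i j (by simp)).trans (h2 j), h1⟩

open Classical in
/-- trees with prescribed (shifted) degrees -/
noncomputable def TS (n m : ℕ) (a : Fin n → ℕ) (b : Fin m → ℕ) : Finset (Fin n → Fin m → Bool) :=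
  Finset.univ.filter fun A => BConn A ∧ (∀ i, ∑ j, (A i j).toNat = a i + 1) ∧
    ∀ j, ∑ i, (A i j).toNat = b j + 1

theorem mem_TS {n m : ℕ} {a : Fin n → ℕ} {b : Fin m → ℕ} {A} :
    A ∈ TS n m a b ↔ BConn A ∧ (∀ i, ∑ j, (A i j).toNat = a i + 1) ∧
      ∀ j, ∑ i, (A i j).toNat = b j + 1 := by
  simp [TS]

theorem TS_flip (n m : ℕ) (a : Fin n → ℕ) (b : Fin m → ℕ) :
    (TS n m a b).card = (TS m n b a).card := by
  refine Finset.card_nbij' (fun A j i => A i j) (fun A j i => A i j) ?_ ?_ ?_ ?_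
  · intro A hA
    simp only [Finset.mem_coe, mem_TS] at hA ⊢
    exact ⟨bconn_flip hA.1, hA.2.2, hA.2.1⟩
  · intro A hA
    simp only [Finset.mem_coe, mem_TS] at hA ⊢
    exact ⟨bconn_flip hA.1, hA.2.2, hA.2.1⟩
  · intro A _; rfl
  · intro A _; rfl

theorem TS_rec (n m : ℕ) (a : Fin (n + 1) → ℕ) (b : Fin m → ℕ) (i : Fin (n + 1)) (hi : a i = 0)
    (hn : 1 ≤ n) :
    (TS (n + 1) m a b).card = ∑ j, if b j = 0 then 0 else
      (TS n m (fun i' => a (i.succAbove i')) (Function.update b j (b j - 1))).card := by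
  have hrow : ∀ (r : Fin m → Bool), (∑ j, (r j).toNat = 1) → ∃ j, r = fun j' => decide (j' = j) := by
    intro r hr
    have : ∑ j, (r j).toNat = (Finset.univ.filter fun j => r j = true).card := by
      rw [Finset.card_filter]
      refine Finset.sum_congr rfl fun j _ => ?_
      cases r j <;> rfl
    rw [this, Finset.card_eq_one] at hr
    obtain ⟨j, hj⟩ := hr
    refine ⟨j, funext fun j' => ?_⟩
    have := Finset.ext_iff.1 hj j'
    simp at this
    rw [Bool.eq_iff_iff, this]; simp
  have hsum : ∀ j : Fin m, ∑ j' : Fin m, (decide (j' = j)).toNat = 1 := by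
    intro j
    rw [Finset.sum_eq_single j] <;> simp +contextual
  classical
  have hcard : (TS (n + 1) m a b).card =
      ∑ j, ((TS (n + 1) m a b).filter fun A => A i = fun j' => decide (j' = j)).card := by
    rw [← Finset.card_biUnion]
    · congr 1
      ext A
      simp only [Finset.mem_biUnion, Finset.mem_univ, true_and, Finset.mem_filter]
      constructor
      · intro hA
        obtain ⟨j, hj⟩ := hrow (A i) (by rw [(mem_TS.1 hA).2.1 i, hi])
        exact ⟨j, hA, hj⟩
      · rintro ⟨j, hA, _⟩; exact hA
    · intro j _ j' _ hne
      rw [Function.onFun, Finset.disjoint_left]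
      intro A hA hA'
      simp only [Finset.mem_filter] at hA hA'
      have := congrFun (hA.2.symm.trans hA'.2) j
      simp at this
      exact hne this
  rw [hcard]
  refine Finset.sum_congr rfl fun j _ => ?_
  split_ifs with hb
  · rw [Finset.card_eq_zero, Finset.filter_eq_empty_iff]
    intro A hA hAi
    obtain ⟨hc, h1, h2⟩ := mem_TS.1 hA
    have h3 := h2 j
    rw [Fin.sum_univ_succAbove _ i, hAi, hb] at h3
    simp at h3
    -- j is isolated from the rest
    obtain ⟨c, k1, k2⟩ := hc (fun i' => i' = i) (fun j' => j' = j) (by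
      rw [Fin.forall_iff_succAbove i]
      refine ⟨?_, ?_⟩
      · intro j' h'
        rw [hAi] at h'
        simpa using h'
      · intro i' j' h'
        simp only [Fin.succAbove_ne, false_iff]
        rintro rfl
        rw [h3 i'] at h'
        simp at h')
    have hcc := (k1 i).1 rfl
    exact Fin.succAbove_ne i ⟨0, hn⟩ ((k1 _).2 hcc)
  · refine Finset.card_nbij' (fun A => i.removeNth A)
      (fun A => Fin.insertNth i (fun j' => decide (j' = j)) A) ?_ ?_ ?_ ?_
    · intro A hA
      simp only [Finset.coe_filter, Set.mem_ofPred_eq, Finset.mem_coe, mem_TS] at hA ⊢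
      obtain ⟨⟨hc, h1, h2⟩, hAi⟩ := hA
      have hA' : A = Fin.insertNth i (fun j' => decide (j' = j)) (i.removeNth A) := by
        rw [← hAi, Fin.insertNth_self_removeNth]
      refine ⟨?_, fun i' => h1 _, fun j' => ?_⟩
      · rw [hA', bconn_insert] at hc
        exact hc
      · have h3 := h2 j'
        rw [Fin.sum_univ_succAbove _ i, hAi] at h3
        simp only [Fin.removeNth]
        rcases eq_or_ne j' j with rfl | hne
        · simp at h3 ⊢; omega
        · simp [hne] at h3 ⊢; omega
    · intro A hA
      simp only [Finset.coe_filter, Set.mem_ofPred_eq, Finset.mem_coe, mem_TS] at hA ⊢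
      obtain ⟨hc, h1, h2⟩ := hA
      refine ⟨⟨(bconn_insert i j A).2 hc, ?_, ?_⟩, by simp⟩
      · rw [Fin.forall_iff_succAbove i]
        refine ⟨?_, ?_⟩
        · simp only [Fin.insertNth_apply_same, hi, hsum]
        · intro i'
          simp only [Fin.insertNth_apply_succAbove]
          exact h1 i'
      · intro j'
        have h3 := h2 j'
        rw [Fin.sum_univ_succAbove _ i]
        simp only [Fin.insertNth_apply_same, Fin.insertNth_apply_succAbove, h3]
        rcases eq_or_ne j' j with rfl | hne
        · simp; omega
        · simp [hne]
    · intro A hA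
      simp only [Finset.coe_filter, Set.mem_ofPred_eq] at hA
      simp only
      rw [← hA.2, Fin.insertNth_self_removeNth]
    · intro A _
      simp
theorem TS_step (n m : ℕ) (a : Fin (n + 1) → ℕ) (b : Fin m → ℕ) (i : Fin (n + 1)) (hi : a i = 0)
    (hn : 1 ≤ n) (ha : ∑ i, a i = m - 1) (hb : ∑ j, b j = n)
    (IH : ∀ (a' : Fin n → ℕ) (b' : Fin m → ℕ), ∑ i, a' i = m - 1 → ∑ j, b' j = n - 1 →
      (TS n m a' b').card * ((∏ i, (a' i).factorial) * ∏ j, (b' j).factorial)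
        = (m - 1).factorial * (n - 1).factorial) :
    (TS (n + 1) m a b).card * ((∏ i, (a i).factorial) * ∏ j, (b j).factorial)
        = (m - 1).factorial * n.factorial := by
  rw [TS_rec n m a b i hi hn, Finset.sum_mul]
  have hterm : ∀ j, (if b j = 0 then 0 else
      (TS n m (fun i' => a (i.succAbove i')) (Function.update b j (b j - 1))).card) *
      ((∏ i, (a i).factorial) * ∏ j, (b j).factorial) =
      b j * ((m - 1).factorial * (n - 1).factorial) := by
    intro j
    split_ifs with h0
    · simp [h0]
    · have hsb : ∑ j', b j' = b j + ∑ j' ∈ Finset.univ.erase j, b j' :=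
        (Finset.add_sum_erase _ _ (Finset.mem_univ j)).symm
      have hsu : ∑ j', Function.update b j (b j - 1) j' =
          (b j - 1) + ∑ j' ∈ Finset.univ.erase j, b j' := by
        rw [← Finset.add_sum_erase _ _ (Finset.mem_univ j)]
        congr 1
        · simp
        · refine Finset.sum_congr rfl fun j' hj' => ?_
          rw [Function.update_of_ne (Finset.ne_of_mem_erase hj')]
      have hpb : ∏ j', (b j').factorial =
          (b j).factorial * ∏ j' ∈ Finset.univ.erase j, (b j').factorial :=
        (Finset.mul_prod_erase _ _ (Finset.mem_univ j)).symm
      have hpu : ∏ j', (Function.update b j (b j - 1) j').factorial =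
          (b j - 1).factorial * ∏ j' ∈ Finset.univ.erase j, (b j').factorial := by
        rw [← Finset.mul_prod_erase _ _ (Finset.mem_univ j)]
        congr 1
        · simp
        · refine Finset.prod_congr rfl fun j' hj' => ?_
          rw [Function.update_of_ne (Finset.ne_of_mem_erase hj')]
      have h := IH (fun i' => a (i.succAbove i')) (Function.update b j (b j - 1))
        (by rw [Fin.sum_univ_succAbove _ i, hi, zero_add] at ha; exact ha)
        (by omega)
      rw [← h, hpb, hpu, Fin.prod_univ_succAbove _ i, hi, ← Nat.mul_factorial_pred h0]
      simp only [Nat.factorial_zero, one_mul]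
      ring
  rw [Finset.sum_congr rfl fun j _ => hterm j, ← Finset.sum_mul, hb,
    ← Nat.mul_factorial_pred (show n ≠ 0 by omega)]
  ring

theorem TS_card (N : ℕ) : ∀ (n m : ℕ) (a : Fin n → ℕ) (b : Fin m → ℕ), n + m = N → 1 ≤ n → 1 ≤ m →
    ∑ i, a i = m - 1 → ∑ j, b j = n - 1 →
    (TS n m a b).card * ((∏ i, (a i).factorial) * ∏ j, (b j).factorial)
        = (m - 1).factorial * (n - 1).factorial := by
  induction N with
  | zero => intro n m a b h1 h2; omega
  | succ N ih =>
    intro n m a b hN hn hm ha hb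
    obtain ⟨n, rfl⟩ : ∃ k, n = k + 1 := ⟨n - 1, by omega⟩
    obtain ⟨m, rfl⟩ : ∃ k, m = k + 1 := ⟨m - 1, by omega⟩
    by_cases h1 : 1 ≤ n ∧ ∃ i, a i = 0
    · obtain ⟨hn1, i, hi⟩ := h1
      exact TS_step n (m + 1) a b i hi hn1 ha (by simpa using hb)
        (fun a' b' ha' hb' => ih n (m + 1) a' b' (by omega) hn1 hm ha' hb')
    by_cases h2 : 1 ≤ m ∧ ∃ j, b j = 0
    · obtain ⟨hm1, j, hj⟩ := h2
      have := TS_step m (n + 1) b a j hj hm1 hb (by simpa using ha)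
        (fun a' b' ha' hb' => ih m (n + 1) a' b' (by omega) hm1 hn ha' hb')
      rw [TS_flip, mul_comm (∏ i, (a i).factorial), this, mul_comm]
      rfl
    have ha1 : 1 ≤ n → n + 1 ≤ ∑ i, a i := by
      intro h
      have : ∑ i : Fin (n + 1), 1 ≤ ∑ i, a i := Finset.sum_le_sum fun i _ => by
        by_contra hc
        exact h1 ⟨h, i, by omega⟩
      simpa using this
    have hb1 : 1 ≤ m → m + 1 ≤ ∑ j, b j := by
      intro h
      have : ∑ i : Fin (m + 1), 1 ≤ ∑ i, b i := Finset.sum_le_sum fun i _ => by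
        by_contra hc
        exact h2 ⟨h, i, by omega⟩
      simpa using this
    obtain rfl : n = 0 := by omega
    obtain rfl : m = 0 := by omega
    have ha0 : a 0 = 0 := by simpa using ha
    have hb0 : b 0 = 0 := by simpa using hb
    have : TS 1 1 a b = {fun _ _ => true} := by
      ext A
      rw [mem_TS, Finset.mem_singleton]
      constructor
      · rintro ⟨_, h, _⟩
        have h := h 0
        funext i j
        rw [Subsingleton.elim i 0, Subsingleton.elim j 0]
        cases hA : A 0 0
        · simp [hA] at h
        · rfl
      · rintro rfl
        refine ⟨?_, ?_, ?_⟩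
        · intro f g hfg
          refine ⟨f 0, fun i => by rw [Subsingleton.elim i 0], fun j => (hfg 0 j rfl).symm⟩
        · intro i; rw [Subsingleton.elim i 0, ha0]; simp
        · intro i; rw [Subsingleton.elim i 0, hb0]; simp
    rw [this]
    simp [ha0, hb0]

theorem bconn_row_pos {n m : ℕ} (hm : 1 ≤ m) {A : Fin n → Fin m → Bool} (h : BConn A) (i : Fin n) :
    0 < ∑ j, (A i j).toNat := by
  rw [Nat.pos_iff_ne_zero]
  intro h0
  have hz : ∀ j, A i j = false := by simpa using h0
  obtain ⟨c, h1, h2⟩ := h (fun i' => i' = i) (fun _ => False) (by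
    intro i' j' hA
    simp only [iff_false]
    rintro rfl
    simp [hz] at hA)
  exact (h2 ⟨0, hm⟩).2 ((h1 i).1 rfl)

open Classical in
theorem card_plbt (n m : ℕ) (hn : 1 ≤ n) (hm : 1 ≤ m) :
    Nat.card (PlaneLabelledBipartiteTree n m) =
      ∑ A : Fin n → Fin m → Bool with BConn A ∧ ∑ i, ∑ j, (A i j).toNat = n + m - 1,
        ((∏ i, (∑ j, (A i j).toNat - 1).factorial) * ∏ j, (∑ i, (A i j).toNat - 1).factorial) := by
  have hce : ∀ A : Fin n → Fin m → Bool,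
      (Finset.univ.filter (fun p : Fin n × Fin m => A p.1 p.2 = true)).card
        = ∑ i, ∑ j, (A i j).toNat := by
    intro A
    rw [Finset.card_filter, Fintype.sum_prod_type]
    refine Finset.sum_congr rfl fun i _ => Finset.sum_congr rfl fun j _ => ?_
    cases A i j <;> rfl
  let P : (Fin n → Fin m → Bool) → Prop :=
    fun A => BConn A ∧ ∑ i, ∑ j, (A i j).toNat = n + m - 1
  let e : PlaneLabelledBipartiteTree n m ≃ Σ A : {A : Fin n → Fin m → Bool // P A},
      (∀ i, {f : Equiv.Perm (Fin m) // f.IsCycleOn {j | A.1 i j = true} ∧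
        ∀ j, A.1 i j = false → f j = j}) ×
      (∀ j, {f : Equiv.Perm (Fin n) // f.IsCycleOn {i | A.1 i j = true} ∧
        ∀ i, A.1 i j = false → f i = i}) :=
    { toFun := fun T => ⟨⟨T.adj, (bconn_iff hm _).1 T.connected, by rw [← hce]; exact T.card_edges⟩,
        fun i => ⟨T.rotW i, T.rotW_cycle i, T.rotW_fix i⟩,
        fun j => ⟨T.rotB j, T.rotB_cycle j, T.rotB_fix j⟩⟩
      invFun := fun x =>
        { adj := x.1.1
          rotW := fun i => (x.2.1 i).1
          rotB := fun j => (x.2.2 j).1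
          rotW_cycle := fun i => (x.2.1 i).2.1
          rotW_fix := fun i => (x.2.1 i).2.2
          rotB_cycle := fun j => (x.2.2 j).2.1
          rotB_fix := fun j => (x.2.2 j).2.2
          connected := (bconn_iff hm _).2 x.1.2.1
          card_edges := by rw [hce]; exact x.1.2.2 }
      left_inv := fun T => rfl
      right_inv := fun x => rfl }
  rw [Nat.card_congr e, Nat.card_sigma, Finset.sum_subtype (p := P) _ (by simp [P])]
  refine Finset.sum_congr rfl fun A _ => ?_
  obtain ⟨A, hc, hA⟩ := A
  rw [Nat.card_prod, Nat.card_pi, Nat.card_pi]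
  congr 1
  · exact Finset.prod_congr rfl fun i _ => cyc_card (A i) (bconn_row_pos hm hc i)
  · exact Finset.prod_congr rfl fun j _ => cyc_card (fun i => A i j)
      (bconn_row_pos hn (bconn_flip hc) j)
/-- The number of plane labelled bipartite trees with `n` white and `m` black vertices
(`n, m ≥ 1`) is `((n+m-2)!)² / ((n-1)!·(m-1)!)` (stated in multiplied-out form, the
division being exact). -/
theorem count_plane_labelled_bipartite_trees (n m : ℕ) (hn : 1 ≤ n) (hm : 1 ≤ m) :
    Nat.card (PlaneLabelledBipartiteTree n m) * ((n - 1).factorial * (m - 1).factorial)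
      = ((n + m - 2).factorial) ^ 2 := by
  classical
  rw [card_plbt n m hn hm]
  have hmaps : ∀ A ∈ (Finset.univ.filter fun A : Fin n → Fin m → Bool =>
      BConn A ∧ ∑ i, ∑ j, (A i j).toNat = n + m - 1),
      ((fun i => ∑ j, (A i j).toNat - 1, fun j => ∑ i, (A i j).toNat - 1) :
        (Fin n → ℕ) × (Fin m → ℕ)) ∈
      (Finset.piAntidiag (Finset.univ : Finset (Fin n)) (m - 1)) ×ˢ
      (Finset.piAntidiag (Finset.univ : Finset (Fin m)) (n - 1)) := by
    intro A hA
    simp only [Finset.mem_filter, Finset.mem_univ, true_and] at hA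
    obtain ⟨hc, hA⟩ := hA
    have e1 : ∑ i, (∑ j, (A i j).toNat - 1) + n = n + m - 1 := by
      rw [← hA]
      have hone : ∀ s : ℕ, s + n = s + ∑ i : Fin n, 1 := by simp
      rw [hone, ← Finset.sum_add_distrib]
      refine Finset.sum_congr (by simp) fun i _ => ?_
      have := bconn_row_pos hm hc i
      omega
    have e2 : ∑ j, (∑ i, (A i j).toNat - 1) + m = n + m - 1 := by
      rw [← hA, Finset.sum_comm]
      have hone : ∀ s : ℕ, s + m = s + ∑ i : Fin m, 1 := by simp
      rw [hone, ← Finset.sum_add_distrib]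
      refine Finset.sum_congr (by simp) fun j _ => ?_
      have := bconn_row_pos hn (bconn_flip hc) j
      omega
    simp only [Finset.mem_product, Finset.mem_piAntidiag, Finset.mem_univ, implies_true, and_true]
    constructor <;> omega
  rw [← Finset.sum_fiberwise_of_maps_to hmaps]
  have hfib : ∀ x ∈ (Finset.piAntidiag (Finset.univ : Finset (Fin n)) (m - 1)) ×ˢ
      (Finset.piAntidiag (Finset.univ : Finset (Fin m)) (n - 1)),
      ∑ A ∈ (Finset.univ.filter fun A : Fin n → Fin m → Bool =>
        BConn A ∧ ∑ i, ∑ j, (A i j).toNat = n + m - 1) with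
        ((fun i => ∑ j, (A i j).toNat - 1, fun j => ∑ i, (A i j).toNat - 1) :
        (Fin n → ℕ) × (Fin m → ℕ)) = x,
        ((∏ i, (∑ j, (A i j).toNat - 1).factorial) * ∏ j, (∑ i, (A i j).toNat - 1).factorial)
      = (m - 1).factorial * (n - 1).factorial := by
    rintro ⟨a, b⟩ hx
    simp only [Finset.mem_product, Finset.mem_piAntidiag, Finset.mem_univ, implies_true,
      and_true] at hx
    rw [← TS_card (n + m) n m a b rfl hn hm hx.1 hx.2, ← smul_eq_mul, ← Finset.sum_const]
    refine Finset.sum_congr ?_ ?_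
    · ext A
      simp only [Finset.mem_filter, Finset.mem_univ, true_and, mem_TS, Prod.mk.injEq]
      constructor
      · rintro ⟨⟨hc, hA⟩, rfl, rfl⟩
        refine ⟨hc, fun i => ?_, fun j => ?_⟩
        · have := bconn_row_pos hm hc i
          dsimp only
          omega
        · have := bconn_row_pos hn (bconn_flip hc) j
          dsimp only
          omega
      · rintro ⟨hc, h1, h2⟩
        refine ⟨⟨hc, ?_⟩, funext fun i => ?_, funext fun j => ?_⟩
        · simp only [h1, Finset.sum_add_distrib, hx.1]
          simp
          omega
        · rw [h1]; rfl
        · rw [h2]; rfl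
    · intro A hA
      obtain ⟨hc, h1, h2⟩ := mem_TS.1 hA
      simp only [h1, h2, Nat.add_sub_cancel]
  rw [Finset.sum_congr rfl hfib, Finset.sum_const, smul_eq_mul, Finset.card_product,
    comp_card n (m - 1) hn, comp_card m (n - 1) hm]
  have c1 := Nat.add_choose_mul_factorial_mul_factorial (n - 1) (m - 1)
  have c2 := Nat.add_choose_mul_factorial_mul_factorial (m - 1) (n - 1)
  rw [show n + m - 2 = n - 1 + (m - 1) by omega, sq]
  have c3 : (n - 1 + (m - 1)).factorial = (m - 1 + (n - 1)).factorial := by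
    rw [add_comm]
  calc _ = ((n - 1 + (m - 1)).choose (m - 1) * (n - 1).factorial * (m - 1).factorial) *
        ((m - 1 + (n - 1)).choose (n - 1) * (m - 1).factorial * (n - 1).factorial) := by ring
    _ = _ := by rw [c1, c2, ← c3]
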